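/- With the vector fields L₁,…,L₆ and the almost complex structure J on ℝ⁶ as in the context: there is no smooth vector field X = aL₃ + bL₄ + cL₅ + dL₆, with a, b, c, d smooth real-valued functions on a neighborhood of 0 in ℝ⁶, such that X(0) = L₅(0) and X commutes at order 4 at 0. -/

import Mathlib

noncomputable section

open Metric

/-- `ℝ^{2n}` identified with `ℂ^n`. -/
abbrev Ecx (n : ℕ) := EuclideanSpace ℂ (Fin n)

/-- The standard complex structure `J₀` (multiplication by `i`), as a real-linear map. -/
def J0 (n : ℕ) : Ecx n →L[ℝ] Ecx n := Complex.I • ContinuousLinearMap.id ℝ (Ecx n)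

variable {F : Type*} [NormedAddCommGroup F] [NormedSpace ℝ F]

/-- `J`-holomorphy of `γ` on a set `D ⊆ ℂ`: `dγ(ζ) ∘ J_st = J(γ ζ) ∘ dγ(ζ)`. -/
def JHolOn (J : F → F →L[ℝ] F) (D : Set ℂ) (γ : ℂ → F) : Prop :=
  ∀ ζ ∈ D, ∀ v : ℂ, fderiv ℝ γ ζ (Complex.I * v) = J (γ ζ) (fderiv ℝ γ ζ v)


/-- Lie bracket of vector fields: `[X,Y](p) = dY(p)(X(p)) − dX(p)(Y(p))`. -/
def lieVF (X Y : F → F) : F → F :=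
  fun p => fderiv ℝ Y p (X p) - fderiv ℝ X p (Y p)

/-- The vector field `JX : x ↦ J(x) X(x)`. -/
def Jvf (J : F → F →L[ℝ] F) (X : F → F) : F → F := fun p => J p (X p)

/-- The flat covariant derivative `X · Y : p ↦ dY(p)(X(p))`. -/
def derVF (X Y : F → F) : F → F := fun p => fderiv ℝ Y p (X p)

/-- `DX X Y k = D_X^{k,0} Y = X·(X·(⋯(X·Y)))` (`k` times). -/
def DX (X Y : F → F) : ℕ → (F → F)
  | 0 => Y
  | k + 1 => derVF X (DX X Y k)

/-- `applyVF [X₁,…,X_k] Z = X₁·(X₂·(⋯(X_k·Z)))`. -/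
def applyVF : List (F → F) → (F → F) → (F → F)
  | [], Z => Z
  | Y :: rest, Z => derVF Y (applyVF rest Z)

/-- `nestedLie [X₁,…,X_k] Z = [X₁,[X₂,[…,[X_k, Z]…]]]`. -/
def nestedLie : List (F → F) → (F → F) → (F → F)
  | [], Z => Z
  | Y :: rest, Z => lieVF Y (nestedLie rest Z)

/-- Selector for elements of `{X, JX}`: `pickVF X JX true = X`, `pickVF X JX false = JX`. -/
def pickVF (X Y : F → F) (b : Bool) : F → F := if b then X else Y

/-- `X` commutes at order `k` at `p`: all iterated Lie brackets of length `l` with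
`2 ≤ l ≤ k` of elements of `{X, JX}` vanish at `p`. -/
def CommutesAtOrder (J : F → F →L[ℝ] F) (X : F → F) (k : ℕ) (p : F) : Prop :=
  ∀ m : ℕ, 1 ≤ m → m + 1 ≤ k → ∀ b : Fin m → Bool, ∀ c : Bool,
    nestedLie (List.ofFn fun i => pickVF X (Jvf J X) (b i))
      (pickVF X (Jvf J X) c) p = 0


/-- `ℝ⁶` with coordinates `(x₁,y₁,x₂,y₂,x₃,y₃) = (p 0, p 1, p 2, p 3, p 4, p 5)`. -/
abbrev R6 := Fin 6 → ℝ

/-- standard basis vector -/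
def e (i : Fin 6) : R6 := Pi.single i 1

/-- `L₁ = ∂/∂x₁` -/
def L1 : R6 → R6 := fun _ => e 0
/-- `L₂ = ∂/∂y₁` -/
def L2 : R6 → R6 := fun _ => e 1
/-- `L₃ = ∂/∂x₂ − (1/2) y₃² ∂/∂x₁` -/
def L3 : R6 → R6 := fun p => e 2 - ((1 / 2) * (p 5) ^ 2) • e 0
/-- `L₄ = ∂/∂y₂ + (x₂ − 2 x₃ y₃) ∂/∂x₁` -/
def L4 : R6 → R6 := fun p => e 3 + (p 2 - 2 * p 4 * p 5) • e 0
/-- `L₅ = ∂/∂x₃ − y₂ y₃ ∂/∂x₁` -/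
def L5 : R6 → R6 := fun p => e 4 - (p 3 * p 5) • e 0
/-- `L₆ = ∂/∂y₃ + x₃ ∂/∂x₂ − (x₃ y₃²/2 + x₃ y₂) ∂/∂x₁` -/
def L6 : R6 → R6 := fun p => e 5 + p 4 • e 2 - (p 4 * (p 5) ^ 2 / 2 + p 4 * p 3) • e 0

/-- the frame conditions determining the almost complex structure `J` -/
def FrameJ (J : R6 → R6 →L[ℝ] R6) : Prop :=
  ∀ p : R6, J p (L1 p) = L2 p ∧ J p (L2 p) = -L1 p ∧ J p (L3 p) = L4 p ∧
    J p (L4 p) = -L3 p ∧ J p (L5 p) = L6 p ∧ J p (L6 p) = -L5 p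

/-- the defining function `φ = y₁` of `M` -/
def phi6 : R6 → ℝ := fun p => p 1

/-- The derivative of `g` along the vector field `X`. -/
def alongVF {G : Type*} [NormedAddCommGroup G] [NormedSpace ℝ G] (X : F → F) (g : F → G) :
    F → G :=
  fun p => fderiv ℝ g p (X p)

section Along

variable {G : Type*} [NormedAddCommGroup G] [NormedSpace ℝ G] {q : F}

lemma ContDiffAt.alongVF {X : F → F} {g : F → G} (hX : ContDiffAt ℝ (⊤ : ℕ∞) X q)
    (hg : ContDiffAt ℝ (⊤ : ℕ∞) g q) : ContDiffAt ℝ (⊤ : ℕ∞) (alongVF X g) q :=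
  (hg.fderiv_right (m := (⊤ : ℕ∞)) (by simp)).clm_apply hX

lemma ContDiffAt.lieVF {X Y : F → F} (hX : ContDiffAt ℝ (⊤ : ℕ∞) X q)
    (hY : ContDiffAt ℝ (⊤ : ℕ∞) Y q) : ContDiffAt ℝ (⊤ : ℕ∞) (lieVF X Y) q :=
  (hX.alongVF hY).sub (hY.alongVF hX)

lemma ContDiffAt.differentiableAt_of_top {g : F → G} (hg : ContDiffAt ℝ (⊤ : ℕ∞) g q) :
    DifferentiableAt ℝ g q :=
  hg.differentiableAt (by simp)

lemma ContDiffAt.eventually_differentiableAt_of_top {g : F → G}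
    (hg : ContDiffAt ℝ (⊤ : ℕ∞) g q) : ∀ᶠ p in nhds q, DifferentiableAt ℝ g p := by
  have h : ContDiffAt ℝ 1 g q := hg.of_le (by exact_mod_cast le_top)
  filter_upwards [h.eventually (by simp)] with p hp
  exact hp.differentiableAt (by simp)

lemma alongVF_eq_zero_of_lieVF {X Z : F → F} (hZ0 : Z q = 0) (h1 : lieVF X Z q = 0) :
    alongVF X Z q = 0 := by
  simpa [lieVF, alongVF, hZ0] using h1

lemma alongVF_alongVF_eq_zero_of_lieVF {X Z : F → F} (hX : ContDiffAt ℝ (⊤ : ℕ∞) X q)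
    (hZ : ContDiffAt ℝ (⊤ : ℕ∞) Z q) (hZ0 : Z q = 0) (h1 : lieVF X Z q = 0)
    (h2 : lieVF X (lieVF X Z) q = 0) : alongVF X (alongVF X Z) q = 0 := by
  have hXZ : fderiv ℝ Z q (X q) = 0 := alongVF_eq_zero_of_lieVF hZ0 h1
  have hdX : DifferentiableAt ℝ (fderiv ℝ X) q :=
    (hX.fderiv_right (m := (⊤ : ℕ∞)) (by simp)).differentiableAt_of_top
  have e1 : fderiv ℝ (lieVF X Z) q (X q) = 0 := by
    have h : fderiv ℝ (lieVF X Z) q (X q) - fderiv ℝ X q (lieVF X Z q) = 0 := h2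
    simpa [h1] using h
  have e2 : fderiv ℝ (lieVF X Z) q =
      fderiv ℝ (alongVF X Z) q - fderiv ℝ (fun p => fderiv ℝ X p (Z p)) q :=
    fderiv_sub (hX.alongVF hZ).differentiableAt_of_top (hZ.alongVF hX).differentiableAt_of_top
  rw [e2, fderiv_clm_apply hdX hZ.differentiableAt_of_top] at e1
  simpa [alongVF, hXZ, hZ0] using e1

/-- If `Z` vanishes to second order along `X`, so does every contraction of `Z`. -/
lemma alongVF_alongVF_clm_apply_eq_zero {X Z : F → F} {θ : F → F →L[ℝ] G}
    (hX : ContDiffAt ℝ (⊤ : ℕ∞) X q) (hZ : ContDiffAt ℝ (⊤ : ℕ∞) Z q)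
    (hθ : ContDiffAt ℝ (⊤ : ℕ∞) θ q) (hZ0 : Z q = 0) (h1 : alongVF X Z q = 0)
    (h2 : alongVF X (alongVF X Z) q = 0) :
    alongVF X (alongVF X fun p => θ p (Z p)) q = 0 := by
  have h1' : fderiv ℝ Z q (X q) = 0 := h1
  have h2' : fderiv ℝ (alongVF X Z) q (X q) = 0 := h2
  have key : (alongVF X fun p => θ p (Z p)) =ᶠ[nhds q]
      fun p => θ p (alongVF X Z p) + alongVF X θ p (Z p) := by
    filter_upwards [hθ.eventually_differentiableAt_of_top,
      hZ.eventually_differentiableAt_of_top] with p hp hp'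
    simp [alongVF, fderiv_clm_apply hp hp']
  have hXθ := (hX.alongVF hθ).differentiableAt_of_top
  have hXZ := (hX.alongVF hZ).differentiableAt_of_top
  have dθ := hθ.differentiableAt_of_top
  have dZ := hZ.differentiableAt_of_top
  change fderiv ℝ (alongVF X fun p => θ p (Z p)) q (X q) = 0
  rw [key.fderiv_eq, fderiv_fun_add (dθ.clm_apply hXZ) (hXθ.clm_apply dZ),
    fderiv_clm_apply dθ hXZ, fderiv_clm_apply hXθ dZ]
  simp [hZ0, h1, h1', h2']

lemma alongVF_eq_zero_of_sq_add_sq {X : F → F} {a b : F → ℝ}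
    (hX : ContDiffAt ℝ (⊤ : ℕ∞) X q) (ha : ContDiffAt ℝ (⊤ : ℕ∞) a q)
    (hb : ContDiffAt ℝ (⊤ : ℕ∞) b q) (ha0 : a q = 0) (hb0 : b q = 0)
    (h : alongVF X (alongVF X fun p => a p ^ 2 + b p ^ 2) q = 0) :
    fderiv ℝ a q (X q) = 0 ∧ fderiv ℝ b q (X q) = 0 := by
  have key : (alongVF X fun p => a p ^ 2 + b p ^ 2) =ᶠ[nhds q]
      fun p => 2 * (a p * alongVF X a p + b p * alongVF X b p) := by
    filter_upwards [ha.eventually_differentiableAt_of_top,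
      hb.eventually_differentiableAt_of_top] with p hp hp'
    simp only [alongVF]
    rw [fderiv_fun_add (hp.fun_pow 2) (hp'.fun_pow 2), fderiv_fun_pow 2 hp,
      fderiv_fun_pow 2 hp']
    simp
    ring
  have dXa := (hX.alongVF ha).differentiableAt_of_top
  have dXb := (hX.alongVF hb).differentiableAt_of_top
  have da := ha.differentiableAt_of_top
  have db := hb.differentiableAt_of_top
  change fderiv ℝ (alongVF X fun p => a p ^ 2 + b p ^ 2) q (X q) = 0 at h
  rw [key.fderiv_eq, fderiv_const_mul ((da.fun_mul dXa).fun_add (db.fun_mul dXb)),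
    fderiv_fun_add (da.fun_mul dXa) (db.fun_mul dXb), fderiv_fun_mul da dXa, fderiv_fun_mul db dXb] at h
  simp [ha0, hb0, alongVF] at h
  constructor <;> nlinarith

/-- Cartan's formula for a form annihilating both fields. -/
lemma clm_apply_lieVF_eq {X Y : F → F} {θ : F → F →L[ℝ] G} (hX : DifferentiableAt ℝ X q)
    (hY : DifferentiableAt ℝ Y q) (hθ : DifferentiableAt ℝ θ q) (hθX : ∀ p, θ p (X p) = 0)
    (hθY : ∀ p, θ p (Y p) = 0) :
    θ q (lieVF X Y q) = fderiv ℝ θ q (Y q) (X q) - fderiv ℝ θ q (X q) (Y q) := by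
  have ex : fderiv ℝ (fun p => θ p (X p)) q (Y q) = 0 := by simp [hθX]
  have ey : fderiv ℝ (fun p => θ p (Y p)) q (X q) = 0 := by simp [hθY]
  rw [fderiv_clm_apply hθ hX] at ex
  rw [fderiv_clm_apply hθ hY] at ey
  simp at ex ey
  rw [lieVF, map_sub, eq_neg_of_add_eq_zero_left ex, eq_neg_of_add_eq_zero_left ey]
  abel

end Along

/-- The coordinate `p ↦ p i` as a continuous linear form. -/
abbrev coordForm (i : Fin 6) : R6 →L[ℝ] ℝ := ContinuousLinearMap.proj i

/-- The component along `L₁` in the frame `(L₁, …, L₆)`. -/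
def formL1 (p : R6) : R6 →L[ℝ] ℝ :=
  coordForm 0 + ((1 / 2) * p 5 ^ 2) • coordForm 2 - (p 2 - 2 * p 4 * p 5) • coordForm 3 +
    (p 3 * p 5) • coordForm 4 + (p 3 * p 4) • coordForm 5

lemma contDiff_formL1 : ContDiff ℝ (⊤ : ℕ∞) formL1 := by
  unfold formL1
  fun_prop

lemma fderiv_formL1_apply (p v w : R6) : fderiv ℝ formL1 p v w =
    p 5 * v 5 * w 2 - (v 2 - 2 * (v 4 * p 5 + p 4 * v 5)) * w 3 +
      (v 3 * p 5 + p 3 * v 5) * w 4 + (v 3 * p 4 + p 3 * v 4) * w 5 := by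
  have hc (i : Fin 6) : HasFDerivAt (fun p : R6 => p i) (coordForm i) p :=
    (coordForm i).hasFDerivAt
  have h := (((((hc 5).pow 2).const_mul (1 / 2)).mul_const (w 2)).const_add (w 0)).sub
    (((hc 2).sub (((hc 4).const_mul 2).mul (hc 5))).mul_const (w 3)) |>.add
    (((hc 3).mul (hc 5)).mul_const (w 4)) |>.add (((hc 3).mul (hc 4)).mul_const (w 5))
  have hd : DifferentiableAt ℝ formL1 p := contDiff_formL1.contDiffAt.differentiableAt_of_top
  have h' := hd.hasFDerivAt.clm_apply (hasFDerivAt_const w p)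
  have e := congrArg (fun T : R6 →L[ℝ] ℝ => T v) (h'.unique h)
  simp at e
  rw [e]
  ring

/-- The vector field `aL₃ + bL₄ + cL₅ + dL₆`. -/
def frameVF (a b c d : R6 → ℝ) : R6 → R6 :=
  fun p => a p • L3 p + b p • L4 p + c p • L5 p + d p • L6 p

section FrameVF

variable (a b c d : R6 → ℝ) (p : R6)

lemma frameVF_two : frameVF a b c d p 2 = a p + d p * p 4 := by
  simp [frameVF, L3, L4, L5, L6, e]

lemma frameVF_three : frameVF a b c d p 3 = b p := by
  simp [frameVF, L3, L4, L5, L6, e]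

lemma frameVF_four : frameVF a b c d p 4 = c p := by
  simp [frameVF, L3, L4, L5, L6, e]

lemma frameVF_five : frameVF a b c d p 5 = d p := by
  simp [frameVF, L3, L4, L5, L6, e]

lemma formL1_frameVF : formL1 p (frameVF a b c d p) = 0 := by
  simp [formL1, frameVF, L3, L4, L5, L6, e]
  ring

lemma Jvf_frameVF {J : R6 → R6 →L[ℝ] R6} (hJ : FrameJ J) :
    Jvf J (frameVF a b c d) = frameVF (-b) a (-d) c := by
  ext1 p
  obtain ⟨-, -, h3, h4, h5, h6⟩ := hJ p
  simp only [Jvf, frameVF, map_add, map_smul, h3, h4, h5, h6, Pi.neg_apply]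
  module

variable {a b c d p}

lemma ContDiffAt.frameVF (ha : ContDiffAt ℝ (⊤ : ℕ∞) a p) (hb : ContDiffAt ℝ (⊤ : ℕ∞) b p)
    (hc : ContDiffAt ℝ (⊤ : ℕ∞) c p) (hd : ContDiffAt ℝ (⊤ : ℕ∞) d p) :
    ContDiffAt ℝ (⊤ : ℕ∞) (frameVF a b c d) p := by
  unfold _root_.frameVF L3 L4 L5 L6
  fun_prop

lemma formL1_lieVF_frameVF (hX : DifferentiableAt ℝ (frameVF a b c d) p)
    (hY : DifferentiableAt ℝ (frameVF (-b) a (-d) c) p) :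
    formL1 p (lieVF (frameVF a b c d) (frameVF (-b) a (-d) c) p) = a p ^ 2 + b p ^ 2 := by
  rw [clm_apply_lieVF_eq hX hY contDiff_formL1.contDiffAt.differentiableAt_of_top
    (formL1_frameVF a b c d) (formL1_frameVF (-b) a (-d) c)]
  simp only [fderiv_formL1_apply, frameVF_two, frameVF_three, frameVF_four, frameVF_five,
    Pi.neg_apply]
  ring

lemma fderiv_apply_coord {V : R6 → R6} (hV : DifferentiableAt ℝ V p) (v : R6) (i : Fin 6) :
    fderiv ℝ V p v i = fderiv ℝ (fun x => V x i) p v := by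
  have := ((coordForm i).hasFDerivAt.comp p hV.hasFDerivAt).fderiv
  exact (congrArg (fun T : R6 →L[ℝ] ℝ => T v) this).symm

lemma fderiv_frameVF_two (ha : DifferentiableAt ℝ a 0) (hd : DifferentiableAt ℝ d 0)
    (hX : DifferentiableAt ℝ (frameVF a b c d) 0) (v : R6) :
    fderiv ℝ (frameVF a b c d) 0 v 2 = fderiv ℝ a 0 v + d 0 * v 4 := by
  rw [fderiv_apply_coord hX]
  simp only [frameVF_two]
  have h4 : HasFDerivAt (fun p : R6 => p 4) (coordForm 4) 0 := (coordForm 4).hasFDerivAt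
  have h := (ha.hasFDerivAt.add (hd.hasFDerivAt.mul h4)).fderiv
  refine (congrArg (fun T : R6 →L[ℝ] ℝ => T v) h).trans ?_
  simp

end FrameVF

/-- key step of Theorem 1.1: no vector field `X = aL₃ + bL₄ + cL₅ + dL₆`
with `X(0) = L₅(0)` commutes at order `4` at `0`. -/
theorem stmt7 (J : R6 → R6 →L[ℝ] R6) (hJ : FrameJ J) :
    ¬ ∃ (U : Set R6) (a b c d : R6 → ℝ),
        IsOpen U ∧ (0 : R6) ∈ U ∧
        ContDiffOn ℝ (⊤ : ℕ∞) a U ∧ ContDiffOn ℝ (⊤ : ℕ∞) b U ∧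
        ContDiffOn ℝ (⊤ : ℕ∞) c U ∧ ContDiffOn ℝ (⊤ : ℕ∞) d U ∧
        (fun p => a p • L3 p + b p • L4 p + c p • L5 p + d p • L6 p) 0 = L5 0 ∧
        CommutesAtOrder J
          (fun p => a p • L3 p + b p • L4 p + c p • L5 p + d p • L6 p) 4 0 := by
  rintro ⟨U, a, b, c, d, hU, h0, ha, hb, hc, hd, hX0, hcomm⟩
  have hU0 := hU.mem_nhds h0
  replace ha := ha.contDiffAt hU0
  replace hb := hb.contDiffAt hU0
  replace hc := hc.contDiffAt hU0
  replace hd := hd.contDiffAt hU0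
  change CommutesAtOrder J (frameVF a b c d) 4 0 at hcomm
  change frameVF a b c d 0 = L5 0 at hX0
  have ha0 : a 0 = 0 := by
    have h := congrFun hX0 2
    rw [frameVF_two] at h
    simpa [L5, e] using h
  have hb0 : b 0 = 0 := by
    have h := congrFun hX0 3
    rw [frameVF_three] at h
    simpa [L5, e] using h
  have hc0 : c 0 = 1 := by
    have h := congrFun hX0 4
    rw [frameVF_four] at h
    simpa [L5, e] using h
  have hd0 : d 0 = 0 := by
    have h := congrFun hX0 5
    rw [frameVF_five] at h
    simpa [L5, e] using h
  have hX := ha.frameVF hb hc hd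
  have hb' : ContDiffAt ℝ (⊤ : ℕ∞) (-b) 0 := hb.neg
  have hd' : ContDiffAt ℝ (⊤ : ℕ∞) (-d) 0 := hd.neg
  have hY := hb'.frameVF ha hd' hc
  have hXY := hX.lieVF hY
  have hform : (fun p => formL1 p (lieVF (frameVF a b c d) (frameVF (-b) a (-d) c) p))
      =ᶠ[nhds 0] fun p => a p ^ 2 + b p ^ 2 := by
    filter_upwards [hX.eventually_differentiableAt_of_top,
      hY.eventually_differentiableAt_of_top] with p hp hp'
    exact formL1_lieVF_frameVF hp hp'
  have hJX := Jvf_frameVF a b c d hJ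
  have hZ0 := hcomm 1 (by norm_num) (by norm_num) (fun _ => true) false
  simp only [List.ofFn_succ, List.ofFn_zero, nestedLie, pickVF, hJX, if_true,
    Bool.false_eq_true, if_false] at hZ0
  have main (s : Bool) :
      fderiv ℝ a 0 (pickVF (frameVF a b c d) (frameVF (-b) a (-d) c) s 0) = 0 ∧
      fderiv ℝ b 0 (pickVF (frameVF a b c d) (frameVF (-b) a (-d) c) s 0) = 0 := by
    have h1 := hcomm 2 (by norm_num) (by norm_num) ![s, true] false
    have h2 := hcomm 3 (by norm_num) (by norm_num) ![s, s, true] false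
    have hV : ContDiffAt ℝ (⊤ : ℕ∞)
        (pickVF (frameVF a b c d) (frameVF (-b) a (-d) c) s) 0 := by
      cases s
      exacts [hY, hX]
    rw [hJX] at h1 h2
    have h3 := alongVF_alongVF_clm_apply_eq_zero hV hXY contDiff_formL1.contDiffAt hZ0
      (alongVF_eq_zero_of_lieVF hZ0 h1) (alongVF_alongVF_eq_zero_of_lieVF hV hXY hZ0 h1 h2)
    refine alongVF_eq_zero_of_sq_add_sq hV ha hb ha0 hb0 ?_
    rw [← h3]
    have h4 := hform.fderiv (𝕜 := ℝ)
    have h5 : (alongVF (pickVF (frameVF a b c d) (frameVF (-b) a (-d) c) s)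
        fun p => a p ^ 2 + b p ^ 2) =ᶠ[nhds 0] alongVF
        (pickVF (frameVF a b c d) (frameVF (-b) a (-d) c) s) fun p =>
          formL1 p (lieVF (frameVF a b c d) (frameVF (-b) a (-d) c) p) := by
      filter_upwards [h4] with p hp
      simp only [alongVF, hp]
    simp only [alongVF, h5.fderiv_eq]
  have hXb : fderiv ℝ b 0 (frameVF a b c d 0) = 0 := (main true).2
  have hYa : fderiv ℝ a 0 (frameVF (-b) a (-d) c 0) = 0 := (main false).1
  have h := congrFun hZ0 2
  simp only [lieVF, Pi.sub_apply] at h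
  rw [fderiv_frameVF_two ha.differentiableAt_of_top hd.differentiableAt_of_top
      hX.differentiableAt_of_top,
    fderiv_frameVF_two hb'.differentiableAt_of_top hc.differentiableAt_of_top
      hY.differentiableAt_of_top, fderiv_neg] at h
  simp [hXb, hYa, hc0, hd0, frameVF_four] at h
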